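/- Suppose the pair (L,σ) is normalised, where L ⊆ V^P is an isotropic subspace free of zero, trivial, and Bell factors, and let T ⊆ P be a subset containing exactly one qubit from each protected contiguity class and no qubit from any gauge-type class. Then every one-parameter subgroup S¹ → A(L,σ) whose support is contained in T (i.e., whose component at every qubit outside T is the identity of SO(3)) is trivial. -/

import Mathlib

/- Common framework: binary stabilizer codes, local unitary/SO(3) automorphism groups. -/

noncomputable section
open scoped Matrix Real ComplexConjugate
open scoped Classical

namespace Stab

/-- The one-qubit phase space `V = 𝔽₂ ⊕ 𝔽₂`, with first coordinate the `z`-component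
and second coordinate the `x`-component. -/
abbrev V : Type := ZMod 2 × ZMod 2

/-- The symplectic form on `V`. -/
def omegaV (u v : V) : ZMod 2 := u.1 * v.2 + u.2 * v.1

/-- The phase space `V^P` over a set of qubits `P`. -/
abbrev QV (P : Type) := P → V

variable {P : Type} [Fintype P] [DecidableEq P]

/-- The direct-sum symplectic form on `V^P`. -/
def omega (u v : QV P) : ZMod 2 := ∑ p, omegaV (u p) (v p)

/-- A subspace `L ⊆ V^P` is isotropic if `ω` vanishes identically on `L × L`. -/
def Isotropic (L : Submodule (ZMod 2) (QV P)) : Prop := ∀ u ∈ L, ∀ v ∈ L, omega u v = 0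

/-- Support of a vector of `V^P`. -/
def supp (v : QV P) : Set P := {p | v p ≠ 0}

/-- The basis vector `z_p`. -/
def zvec (p : P) : QV P := Pi.single p ((1 : ZMod 2), (0 : ZMod 2))

/-- The basis vector `x_p`. -/
def xvec (p : P) : QV P := Pi.single p ((0 : ZMod 2), (1 : ZMod 2))

/-- Restriction (coordinate projection) of a vector to a subset `S ⊆ P`. -/
def restrTo (S : Set P) (v : QV P) : QV P := fun p => if p ∈ S then v p else 0

/-- The coordinate subspace `V^S ⊆ V^P`. -/
def coordSub (S : Set P) : Submodule (ZMod 2) (QV P) where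
  carrier := {v | ∀ p ∉ S, v p = 0}
  add_mem' := by intro a b ha hb p hp; simp [Pi.add_apply, ha p hp, hb p hp]
  zero_mem' := by intro p _; rfl
  smul_mem' := by intro c a ha p hp; simp [Pi.smul_apply, ha p hp]

/-- `L_S := L ∩ V^S`. -/
def LS (L : Submodule (ZMod 2) (QV P)) (S : Set P) : Submodule (ZMod 2) (QV P) :=
  L ⊓ coordSub S

/-- `L` splits as a direct factor on `S`, i.e. `L = L_S × L_{P∖S}`. -/
def SplitsOn (L : Submodule (ZMod 2) (QV P)) (S : Set P) : Prop :=
  ∀ v ∈ L, restrTo S v ∈ L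

/-- `L` splits off a zero factor: on some nonempty `S ⊆ P` all vectors of `L` vanish. -/
def HasZeroFactor (L : Submodule (ZMod 2) (QV P)) : Prop :=
  ∃ S : Set P, S.Nonempty ∧ ∀ v ∈ L, ∀ p ∈ S, v p = 0

/-- The qubit `p` is trivial: `L` splits off a one-dimensional factor on `{p}`. -/
def TrivialQubit (L : Submodule (ZMod 2) (QV P)) (p : P) : Prop :=
  SplitsOn L {p} ∧ ∃ v ∈ L, v ≠ 0 ∧ supp v ⊆ {p}

/-- `L` splits off a trivial factor. -/
def HasTrivialFactor (L : Submodule (ZMod 2) (QV P)) : Prop :=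
  ∃ p : P, TrivialQubit L p

/-- `L` splits off a Bell Lagrangian: an indecomposable Lagrangian direct factor on a
two-element set of qubits (all of whose nonzero vectors have full support `{p, q}`). -/
def HasBellFactor (L : Submodule (ZMod 2) (QV P)) : Prop :=
  ∃ p q : P, p ≠ q ∧ SplitsOn L {p, q} ∧
    ∃ v ∈ L, ∃ w ∈ L, v ≠ w ∧ supp v = {p, q} ∧ supp w = {p, q} ∧ supp (v + w) = {p, q}

/-- The factor `L_S` (for `S` in a partition) is indecomposable. -/
def IndecompWithin (L : Submodule (ZMod 2) (QV P)) (S : Set P) : Prop :=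
  ∀ T ⊆ S, SplitsOn L T → T = ∅ ∨ T = S

/-! ### The Hilbert space, Pauli operators and stabilizer codes -/

/-- The state space `ℋ^{⊗P} = (ℂ²)^{⊗P}`, realised concretely as functions on
computational basis labels. -/
abbrev HP (P : Type) := (P → Fin 2) → ℂ

/-- Operators on `ℋ^{⊗P}` as matrices. -/
abbrev MatP (P : Type) := Matrix (P → Fin 2) (P → Fin 2) ℂ

/-- The tensor (local) operator `⊗_{p} g_p` on `ℋ^{⊗P}`. -/
def locOp (g : P → Matrix (Fin 2) (Fin 2) ℂ) : MatP P :=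
  Matrix.of fun u w => ∏ p, g p (u p) (w p)

def sigmaX : Matrix (Fin 2) (Fin 2) ℂ := !![0, 1; 1, 0]
def sigmaY : Matrix (Fin 2) (Fin 2) ℂ := !![0, -Complex.I; Complex.I, 0]
def sigmaZ : Matrix (Fin 2) (Fin 2) ℂ := !![1, 0; 0, -1]

/-- The one-qubit Pauli operator `Z^a X^b` attached to `(a, b) ∈ V`. -/
def pauliMat (v : V) : Matrix (Fin 2) (Fin 2) ℂ := sigmaZ ^ (v.1 : ZMod 2).val * sigmaX ^ (v.2 : ZMod 2).val

/-- The Pauli (Weyl) operator attached to `v ∈ V^P`. -/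
def Wop (v : QV P) : MatP P := locOp fun p => pauliMat (v p)

/-- A group-homomorphic section `σ` over `L` of the projection from the Pauli group
`Ṽ^P` onto `V^P`: each value `σ(v)` is a unitary scalar multiple of the Pauli operator
`W(v)`, and `σ` is multiplicative on `L`. -/
structure PauliSection (L : Submodule (ZMod 2) (QV P)) where
  toFun : QV P → MatP P
  scalar : ∀ v : QV P, ∃ c : ℂ, toFun v = c • Wop v
  unitary : ∀ v : QV P, toFun v ∈ Matrix.unitaryGroup (P → Fin 2) ℂ
  mul_of_mem : ∀ u ∈ L, ∀ v ∈ L, toFun (u + v) = toFun u * toFun v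
  map_zero : toFun 0 = 1

/-- The stabilizer code `C(L, σ)`: the common fixed-point space of the stabilizer
group `σ(L)`. -/
def code (L : Submodule (ZMod 2) (QV P)) (σ : PauliSection L) : Submodule ℂ (HP P) where
  carrier := {ψ | ∀ v ∈ L, σ.toFun v *ᵥ ψ = ψ}
  add_mem' := by intro a b ha hb v hv; rw [Matrix.mulVec_add, ha v hv, hb v hv]
  zero_mem' := by intro v hv; simp
  smul_mem' := by intro c a ha v hv; rw [Matrix.mulVec_smul, ha v hv]

/-- The standard section: `σ(v) = W(v)` on `L`. -/
def StandardOn (L : Submodule (ZMod 2) (QV P)) (σ : PauliSection L) : Prop :=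
  ∀ v ∈ L, σ.toFun v = Wop v

/-! ### `SO(3)`, rotations, and the automorphism group of a code -/

/-- `3×3` real matrices. -/
abbrev Rot : Type := Matrix (Fin 3) (Fin 3) ℝ

/-- `SO(3)` as a set of `3×3` real matrices. -/
def SO3 : Set Rot := {A | A * Aᵀ = 1 ∧ A.det = 1}

/-- The ordered Pauli basis (x, y, z) of traceless Hermitian `2×2` matrices. -/
def pauliBasis : Fin 3 → Matrix (Fin 2) (Fin 2) ℂ := ![sigmaX, sigmaY, sigmaZ]

/-- The image of a unitary `u ∈ U(2)` in `SO(3)` under the adjoint action on traceless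
Hermitian operators (the identification `U(2)/S¹ = SO(3)`):
`u σ_j u† = Σ_i (adjRot u)_{ij} σ_i`. -/
def adjRot (u : Matrix (Fin 2) (Fin 2) ℂ) : Rot :=
  Matrix.of fun i j =>
    (1 / 2 : ℝ) * ((pauliBasis i * u * pauliBasis j * u.conjTranspose).trace).re

/-- Rotation about the `x`-axis by angle `θ`. -/
def rotX (θ : ℝ) : Rot := !![1, 0, 0; 0, Real.cos θ, -Real.sin θ; 0, Real.sin θ, Real.cos θ]

/-- Rotation about the `y`-axis by angle `θ`. -/
def rotY (θ : ℝ) : Rot := !![Real.cos θ, 0, Real.sin θ; 0, 1, 0; -Real.sin θ, 0, Real.cos θ]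

/-- Rotation about the `z`-axis by angle `θ`. -/
def rotZ (θ : ℝ) : Rot := !![Real.cos θ, -Real.sin θ, 0; Real.sin θ, Real.cos θ, 0; 0, 0, 1]

/-- The circle group `C_x ⊆ SO(3)` of rotations about the `x`-axis. -/
def Cx : Set Rot := Set.range rotX

/-- The circle group `C_y ⊆ SO(3)` of rotations about the `y`-axis. -/
def Cy : Set Rot := Set.range rotY

/-- The circle group `C_z ⊆ SO(3)` of rotations about the `z`-axis. -/
def Cz : Set Rot := Set.range rotZ

/-- The octahedral group: the subgroup of `SO(3)` generated by the rotations by a right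
angle about the three coordinate axes. -/
def octahedral : Set Rot :=
  (Submonoid.closure {rotX (π / 2), rotY (π / 2), rotZ (π / 2)} : Submonoid Rot)

/-- The infinite dihedral group `D_x ⊆ SO(3)`. -/
def Dx : Set Rot := (Submonoid.closure (Cx ∪ {rotZ π}) : Submonoid Rot)

/-- The infinite dihedral group `D_y ⊆ SO(3)`. -/
def Dy : Set Rot := (Submonoid.closure (Cy ∪ {rotZ π}) : Submonoid Rot)

/-- The infinite dihedral group `D_z ⊆ SO(3)`. -/
def Dz : Set Rot := (Submonoid.closure (Cz ∪ {rotX π}) : Submonoid Rot)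

/-- The automorphism group `A(L, σ) ⊆ SO(3)^P` of the stabilizer code `C(L, σ)`:
all families of rotations admitting a local unitary lift mapping the code into itself. -/
def autSet (L : Submodule (ZMod 2) (QV P)) (σ : PauliSection L) : Set (P → Rot) :=
  {g | ∃ u : P → Matrix (Fin 2) (Fin 2) ℂ,
        (∀ p, u p ∈ Matrix.unitaryGroup (Fin 2) ℂ) ∧
        (∀ p, adjRot (u p) = g p) ∧
        ∀ ψ ∈ code L σ, locOp u *ᵥ ψ ∈ code L σ}

/-- The automorphism group `A(L, σ)_p` at the qubit `p`. -/
def autSetAt (L : Submodule (ZMod 2) (QV P)) (σ : PauliSection L) (p : P) : Set Rot :=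
  (fun g => g p) '' autSet L σ

/-- The normal subgroup `Z(L, σ)` of automorphisms acting by a scalar on the code. -/
def zSet (L : Submodule (ZMod 2) (QV P)) (σ : PauliSection L) : Set (P → Rot) :=
  {g | ∃ u : P → Matrix (Fin 2) (Fin 2) ℂ,
        (∀ p, u p ∈ Matrix.unitaryGroup (Fin 2) ℂ) ∧
        (∀ p, adjRot (u p) = g p) ∧
        ∃ c : ℂ, ∀ ψ ∈ code L σ, locOp u *ᵥ ψ = c • ψ}

/-! ### Restriction to subsets of qubits -/

/-- Restriction of a phase-space vector to the qubits of `S`. -/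
def resQV (S : Set P) (v : QV P) : QV ↥S := fun s => v s

/-- Restriction as a linear map. -/
def resLin (S : Set P) : QV P →ₗ[ZMod 2] QV ↥S where
  toFun := resQV S
  map_add' := by intros; rfl
  map_smul' := by intros; rfl

/-- `L_S`, regarded as a subspace of `V^S`. -/
def LSsub (L : Submodule (ZMod 2) (QV P)) (S : Set P) : Submodule (ZMod 2) (QV ↥S) :=
  Submodule.map (resLin S) (LS L S)

/-- The extension `M ⊗ 1` to `ℋ^{⊗P}` of an operator `M` on `ℋ^{⊗S}`. -/
def extendOp (S : Set P) (M : Matrix (↥S → Fin 2) (↥S → Fin 2) ℂ) : MatP P :=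
  Matrix.of fun u w =>
    if ∀ p ∉ S, u p = w p then M (fun s => u s) (fun s => w s) else 0

/-- `σ'` is the restriction `σ|_{L_S}` of the section `σ` to `L_S`. -/
def RestrictedSection (L : Submodule (ZMod 2) (QV P)) (σ : PauliSection L) (S : Set P)
    (σ' : PauliSection (LSsub L S)) : Prop :=
  ∀ v ∈ LS L S, extendOp S (σ'.toFun (resQV S v)) = σ.toFun v

/-! ### Contiguity, protected and gauge qubits, and normal forms -/

/-- Two qubits are contiguous if they are equal or `L` contains a vector supported
exactly on the pair. -/
def Contig (L : Submodule (ZMod 2) (QV P)) (p q : P) : Prop :=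
  p = q ∨ ∃ v ∈ L, supp v = ({p, q} : Set P)

/-- The contiguity class of a qubit. -/
def contigClass (L : Submodule (ZMod 2) (QV P)) (p : P) : Set P := {q | Contig L p q}

/-- The qubit `p` is protected: the projection `L → V^{{p}}` is surjective. -/
def IsProtected (L : Submodule (ZMod 2) (QV P)) (p : P) : Prop :=
  ∀ w : V, ∃ v ∈ L, v p = w

/-- The qubit `p` is of gauge type: the projection `L → V^{{p}}` has a line as image. -/
def IsGauge (L : Submodule (ZMod 2) (QV P)) (p : P) : Prop :=
  ¬ IsProtected L p ∧ ∃ v ∈ L, v p ≠ 0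

/-- The subspace `⟨z_a + z_b : a ≠ b ∈ S⟩`. -/
def zspan (S : Set P) : Submodule (ZMod 2) (QV P) :=
  Submodule.span (ZMod 2) {w | ∃ a ∈ S, ∃ b ∈ S, a ≠ b ∧ w = zvec a + zvec b}

/-- The vector `Σ_{s ∈ S} x_s`. -/
def xsumOn (S : Set P) : QV P := S.indicator fun _ => ((0 : ZMod 2), (1 : ZMod 2))

/-- Normal form of `L` (conclusion of the normalisation lemma): every contiguity class `S`
carries either `⟨z_a + z_b⟩` or `⟨z_a + z_b⟩ + ⟨Σ_{s∈S} x_s⟩`. -/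
def NormalForm (L : Submodule (ZMod 2) (QV P)) : Prop :=
  ∀ p : P,
    LS L (contigClass L p) = zspan (contigClass L p) ∨
    LS L (contigClass L p) =
      zspan (contigClass L p) ⊔ Submodule.span (ZMod 2) {xsumOn (contigClass L p)}

/-- The pair `(L, σ)` is normalised. -/
def Normalised (L : Submodule (ZMod 2) (QV P)) (σ : PauliSection L) : Prop :=
  NormalForm L ∧
  (∀ p : P, IsGauge L p → contigClass L p = {p} → ∀ v ∈ L, (v p).2 = 0) ∧
  (∀ p : P, IsProtected L p → contigClass L p = {p} →
    connectedComponentIn (autSetAt L σ p) 1 ⊆ Cz) ∧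
  (∀ p : P, IsProtected L p → contigClass L p ≠ {p} →
    LS L (contigClass L p) = zspan (contigClass L p) →
    ∃ v ∈ L, ∀ s ∈ contigClass L p, v s = ((0 : ZMod 2), (1 : ZMod 2))) ∧
  (∀ p q : P, p ≠ q → Contig L p q →
    σ.toFun (zvec p + zvec q) = Wop (zvec p + zvec q))

/-- A local symplectic family of automorphisms of `V`. -/
def IsLocalSymp (f : P → (V ≃ₗ[ZMod 2] V)) : Prop :=
  ∀ (p : P) (u v : V), omegaV (f p u) (f p v) = omegaV u v

/-- The image of `L` under a local (symplectic) transformation. -/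
def mapL (L : Submodule (ZMod 2) (QV P)) (f : P → (V ≃ₗ[ZMod 2] V)) :
    Submodule (ZMod 2) (QV P) :=
  Submodule.map (LinearEquiv.piCongrRight f : QV P ≃ₗ[ZMod 2] QV P).toLinearMap L

/-! ### Abstract group structures carried by subsets of a monoid -/

/-- The set `s` carries the structure of a solvable group. -/
structure SolvableGroupStructure (M : Type) [Monoid M] (s : Set M) where
  G : Type
  [grp : Group G]
  solv : IsSolvable G
  f : G → M
  inj : Function.Injective f
  map_mul : ∀ a b : G, f (a * b) = f a * f b
  range_eq : Set.range f = s

/-- The quotient of the group (carried by) `A` by the normal subgroup (carried by) `Z`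
is a compact solvable topological (Lie) group. -/
structure CompactSolvableQuotientStructure (M : Type) [Monoid M] [TopologicalSpace M]
    (A Z : Set M) where
  G : Type
  [grp : Group G]
  [top : TopologicalSpace G]
  [tgrp : IsTopologicalGroup G]
  cpt : CompactSpace G
  solv : IsSolvable G
  φ : M → G
  cont : ContinuousOn φ A
  map_mul' : ∀ a ∈ A, ∀ b ∈ A, φ (a * b) = φ a * φ b
  surj : ∀ y : G, ∃ a ∈ A, φ a = y
  ker : ∀ a ∈ A, (φ a = 1 ↔ a ∈ Z)

/-! ### Logical qubits and transversally realisable gates -/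

/-- The standard hermitian inner product on a finite-dimensional function space. -/
def innerF {ι : Type} [Fintype ι] (ψ φ : ι → ℂ) : ℂ := ∑ i, (starRingEnd ℂ) (ψ i) * φ i

/-- `e` is a unitary identification of the code space with a space of logical qubits. -/
def IsUnitaryEquiv (L : Submodule (ZMod 2) (QV P)) (σ : PauliSection L) {d : ℕ}
    (e : ↥(code L σ) ≃ₗ[ℂ] HP (Fin d)) : Prop :=
  ∀ ψ φ : ↥(code L σ),
    innerF (e ψ) (e φ) = innerF (ψ : HP P) (φ : HP P)

/-- The operator acting as `w` on the logical qubit `k` and trivially elsewhere. -/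
def oneQubitOp (d : ℕ) (k : Fin d) (w : Matrix (Fin 2) (Fin 2) ℂ) : MatP (Fin d) :=
  locOp fun j => if j = k then w else 1

/-- The set of rotations in `SO(3)` induced, via the identification `e`, on a fixed
logical qubit `k` by (exactly realised) transversal gates, i.e. by elements of `A(L, σ)`. -/
def logicalSet (L : Submodule (ZMod 2) (QV P)) (σ : PauliSection L) {d : ℕ}
    (e : ↥(code L σ) ≃ₗ[ℂ] HP (Fin d)) (k : Fin d) : Set Rot :=
  {A | ∃ w ∈ Matrix.unitaryGroup (Fin 2) ℂ, adjRot w = A ∧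
        ∃ u : P → Matrix (Fin 2) (Fin 2) ℂ,
          (∀ p, u p ∈ Matrix.unitaryGroup (Fin 2) ℂ) ∧
          ∀ φ : HP (Fin d),
            locOp u *ᵥ ((e.symm φ : HP P)) = ((e.symm (oneQubitOp d k w *ᵥ φ) : HP P))}

/-! ### Reed–Muller codes -/

/-- The qubit set `P = 𝔽₂^m ∖ {0}`. -/
abbrev RMQubits (m : ℕ) := {s : Fin m → ZMod 2 // s ≠ 0}

/-- Polynomial functions on `𝔽₂^m` of degree at most `r` with zero constant term. -/
def RMspan (r m : ℕ) : Submodule (ZMod 2) ((Fin m → ZMod 2) → ZMod 2) :=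
  Submodule.span (ZMod 2)
    {f | ∃ I : Finset (Fin m), I.Nonempty ∧ I.card ≤ r ∧ f = fun s => ∏ i ∈ I, s i}

/-- The shortened Reed–Muller code `R_*(r, m) ⊆ 𝔽₂^P`. -/
def RMstar (r m : ℕ) : Submodule (ZMod 2) (RMQubits m → ZMod 2) :=
  Submodule.map (LinearMap.funLeft (ZMod 2) (ZMod 2) Subtype.val) (RMspan r m)

/-- The `z`-part of a phase-space vector. -/
def zPart {P : Type} : QV P →ₗ[ZMod 2] (P → ZMod 2) where
  toFun v := fun p => (v p).1
  map_add' := by intros; rfl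
  map_smul' := by intros; rfl

/-- The `x`-part of a phase-space vector. -/
def xPart {P : Type} : QV P →ₗ[ZMod 2] (P → ZMod 2) where
  toFun v := fun p => (v p).2
  map_add' := by intros; rfl
  map_smul' := by intros; rfl

/-- The Calderbank–Shor–Steane isotropic subspace built from the shortened Reed–Muller
codes `R_*(m−2, m)` (in the `z`-coordinates) and `R_*(1, m)` (in the `x`-coordinates). -/
def cssL (m : ℕ) : Submodule (ZMod 2) (QV (RMQubits m)) :=
  Submodule.comap zPart (RMstar (m - 2) m) ⊓ Submodule.comap xPart (RMstar 1 m)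

/-- The stabilizer state `|0⟩_S ⊗ |0⟩_T + |0⟩_S ⊗ |1⟩_T + |1⟩_S ⊗ |0⟩_T − |1⟩_S ⊗ |1⟩_T`
(with `T = Sᶜ`), written in the computational basis. -/
def bellLike (S : Set P) (p q : P) : HP P := fun u =>
  if (∀ a ∈ S, u a = u p) ∧ (∀ a ∈ Sᶜ, u a = u q) then
    ((-1 : ℂ)) ^ ((u p : Fin 2).val * (u q : Fin 2).val) else 0


section LocalOperators

variable {P : Type} [Fintype P] [DecidableEq P]

lemma locOp_mul (f g : P → Matrix (Fin 2) (Fin 2) ℂ) :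
    locOp f * locOp g = locOp fun p => f p * g p := by
  ext u w
  simp only [locOp, Matrix.mul_apply, Matrix.of_apply, ← Finset.prod_mul_distrib]
  rw [Finset.prod_univ_sum, Fintype.piFinset_univ]

lemma trace_locOp (f : P → Matrix (Fin 2) (Fin 2) ℂ) :
    (locOp f).trace = ∏ p, (f p).trace := by
  simp only [locOp, Matrix.trace, Matrix.diag, Matrix.of_apply]
  rw [Finset.prod_univ_sum, Fintype.piFinset_univ]

lemma locOp_one : locOp (fun _ : P => (1 : Matrix (Fin 2) (Fin 2) ℂ)) = 1 := by
  ext u w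
  simp only [locOp, Matrix.of_apply, Matrix.one_apply]
  rw [Finset.prod_ite_zero]
  simp [funext_iff]

lemma conjTranspose_locOp (f : P → Matrix (Fin 2) (Fin 2) ℂ) :
    (locOp f)ᴴ = locOp fun p => (f p)ᴴ := by
  ext u w
  simp [locOp, Matrix.conjTranspose_apply]

lemma locOp_smul (c : P → ℂ) (f : P → Matrix (Fin 2) (Fin 2) ℂ) :
    locOp (fun p => c p • f p) = (∏ p, c p) • locOp f := by
  ext u w
  simp [locOp, Finset.prod_mul_distrib]

end LocalOperators

section OneQubit

lemma V_cases (v : V) : v = (0, 0) ∨ v = (0, 1) ∨ v = (1, 0) ∨ v = (1, 1) := by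
  revert v; decide

lemma exists_omegaV_ne_zero {v : V} (hv : v ≠ 0) : ∃ w, omegaV v w ≠ 0 := by
  revert v; simp only [omegaV]; decide

lemma pauliMat_unitary (v : V) : (pauliMat v)ᴴ * pauliMat v = 1 := by
  rcases V_cases v with rfl | rfl | rfl | rfl <;> ext i j <;> fin_cases i <;> fin_cases j <;>
    simp [pauliMat, sigmaX, sigmaZ, Matrix.mul_apply, Fin.sum_univ_two, ZMod.val_one]

lemma pauliMat_anticomm {v w : V} (h : omegaV v w ≠ 0) :
    (pauliMat v)ᴴ * pauliMat w = (-1 : ℂ) • (pauliMat w * (pauliMat v)ᴴ) := by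
  rcases V_cases v with rfl | rfl | rfl | rfl <;>
  rcases V_cases w with rfl | rfl | rfl | rfl <;>
  first
  | (exfalso; revert h; simp only [omegaV]; decide)
  | (ext i j; fin_cases i <;> fin_cases j <;>
      simp [pauliMat, sigmaX, sigmaZ, Matrix.mul_apply, Matrix.vecMul, dotProduct,
        Fin.sum_univ_two, ZMod.val_one])

/-- The absolute value of the coefficient of `u` at the Pauli operator of `w`. -/
def pauliCoeff (u : Matrix (Fin 2) (Fin 2) ℂ) (w : V) : ℝ := ‖((pauliMat w)ᴴ * u).trace‖ / 2

lemma pauliCoeff_nonneg (u : Matrix (Fin 2) (Fin 2) ℂ) (w : V) : 0 ≤ pauliCoeff u w := by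
  unfold pauliCoeff; positivity

lemma norm_trace_pauliMat (u : Matrix (Fin 2) (Fin 2) ℂ) (v w : V) :
    ‖((pauliMat v)ᴴ * u * pauliMat w).trace‖ = 2 * pauliCoeff u (v + w) := by
  have key : ∃ c : ℂ, ‖c‖ = 1 ∧ pauliMat w * (pauliMat v)ᴴ = c • (pauliMat (v + w))ᴴ := by
    have h2 : (1 : ZMod 2) + 1 = 0 := by decide
    rcases V_cases v with rfl | rfl | rfl | rfl <;>
    rcases V_cases w with rfl | rfl | rfl | rfl <;>
    first
    | (refine ⟨1, by simp, ?_⟩; ext i j; fin_cases i <;> fin_cases j <;>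
        simp [pauliMat, sigmaX, sigmaZ, Matrix.mul_apply, Fin.sum_univ_two, ZMod.val_one, h2]; done)
    | (refine ⟨-1, by simp, ?_⟩; ext i j; fin_cases i <;> fin_cases j <;>
        simp [pauliMat, sigmaX, sigmaZ, Matrix.mul_apply, Fin.sum_univ_two, ZMod.val_one, h2])
  obtain ⟨c, hc, h⟩ := key
  rw [Matrix.trace_mul_comm, ← mul_assoc, h, smul_mul_assoc, Matrix.trace_smul, norm_smul, hc,
    pauliCoeff]
  ring

lemma pauliCoeff_sq (u : Matrix (Fin 2) (Fin 2) ℂ) :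
    pauliCoeff u (0, 0) ^ 2 = Complex.normSq (u 0 0 + u 1 1) / 4 ∧
    pauliCoeff u (0, 1) ^ 2 = Complex.normSq (u 0 1 + u 1 0) / 4 ∧
    pauliCoeff u (1, 0) ^ 2 = Complex.normSq (u 0 0 - u 1 1) / 4 ∧
    pauliCoeff u (1, 1) ^ 2 = Complex.normSq (u 0 1 - u 1 0) / 4 := by
  simp only [pauliCoeff, div_pow, Complex.sq_norm]
  refine ⟨?_, ?_, ?_, ?_⟩ <;>
    simp [pauliMat, sigmaX, sigmaZ, Matrix.trace, Matrix.mul_apply, Fin.sum_univ_two,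
      ZMod.val_one, Complex.normSq_apply] <;> ring

lemma unitary_normSq {u : Matrix (Fin 2) (Fin 2) ℂ} (hu : u ∈ Matrix.unitaryGroup (Fin 2) ℂ) :
    Complex.normSq (u 0 0) + Complex.normSq (u 0 1) = 1 ∧
    Complex.normSq (u 1 0) + Complex.normSq (u 1 1) = 1 := by
  have h := Matrix.mem_unitaryGroup_iff.mp hu
  have h0 := congrArg Complex.re (congrFun (congrFun h 0) 0)
  have h1 := congrArg Complex.re (congrFun (congrFun h 1) 1)
  simp [Matrix.mul_apply, Fin.sum_univ_two, Matrix.star_apply] at h0 h1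
  simp only [Complex.normSq_apply]
  constructor <;> linarith

lemma sum_pauliCoeff_sq {u : Matrix (Fin 2) (Fin 2) ℂ}
    (hu : u ∈ Matrix.unitaryGroup (Fin 2) ℂ) :
    pauliCoeff u (0, 0) ^ 2 + pauliCoeff u (0, 1) ^ 2 + pauliCoeff u (1, 0) ^ 2 +
      pauliCoeff u (1, 1) ^ 2 = 1 := by
  obtain ⟨h0, h1⟩ := unitary_normSq hu
  obtain ⟨e0, e1, e2, e3⟩ := pauliCoeff_sq u
  rw [e0, e1, e2, e3]
  simp only [Complex.normSq_apply, Complex.add_re, Complex.add_im, Complex.sub_re,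
    Complex.sub_im] at *
  linarith

lemma pauliCoeff_le_one {u : Matrix (Fin 2) (Fin 2) ℂ}
    (hu : u ∈ Matrix.unitaryGroup (Fin 2) ℂ) (w : V) : pauliCoeff u w ≤ 1 := by
  have h := sum_pauliCoeff_sq hu
  have : pauliCoeff u w ^ 2 ≤ 1 := by
    rcases V_cases w with rfl | rfl | rfl | rfl <;> nlinarith [sq_nonneg (pauliCoeff u (0, 0)),
      sq_nonneg (pauliCoeff u (0, 1)), sq_nonneg (pauliCoeff u (1, 0)),
      sq_nonneg (pauliCoeff u (1, 1))]
  nlinarith [pauliCoeff_nonneg u w]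

lemma pauliCoeff_sq_le {u : Matrix (Fin 2) (Fin 2) ℂ}
    (hu : u ∈ Matrix.unitaryGroup (Fin 2) ℂ) {w : V} (hw : w ≠ 0) :
    pauliCoeff u w ^ 2 ≤ 1 - pauliCoeff u 0 ^ 2 := by
  have h := sum_pauliCoeff_sq hu
  rw [show (0 : V) = (0, 0) from rfl] at hw ⊢
  rcases V_cases w with rfl | rfl | rfl | rfl
  · exact absurd rfl hw
  all_goals nlinarith [sq_nonneg (pauliCoeff u (0, 1)), sq_nonneg (pauliCoeff u (1, 0)),
      sq_nonneg (pauliCoeff u (1, 1))]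

lemma pauliCoeff_zero_sq {u : Matrix (Fin 2) (Fin 2) ℂ}
    (hu : u ∈ Matrix.unitaryGroup (Fin 2) ℂ) :
    pauliCoeff u 0 ^ 2 = (1 + (adjRot u).trace) / 4 := by
  obtain ⟨h0, h1⟩ := unitary_normSq hu
  rw [show (0 : V) = (0, 0) from rfl, (pauliCoeff_sq u).1]
  simp [adjRot, pauliBasis, sigmaX, sigmaY, sigmaZ, Matrix.trace, Matrix.mul_apply,
    Fin.sum_univ_two, Fin.sum_univ_three, Complex.normSq_apply,
    Matrix.conjTranspose_apply] at *
  linarith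

lemma adjRot_eq_one {u : Matrix (Fin 2) (Fin 2) ℂ}
    (hu : u ∈ Matrix.unitaryGroup (Fin 2) ℂ) (h : ∀ w : V, w ≠ 0 → pauliCoeff u w = 0) :
    adjRot u = 1 := by
  obtain ⟨-, e1, e2, e3⟩ := pauliCoeff_sq u
  rw [h _ (by decide)] at e1 e2 e3
  have z1 : u 0 1 + u 1 0 = 0 := Complex.normSq_eq_zero.mp (by linarith)
  have z2 : u 0 0 - u 1 1 = 0 := Complex.normSq_eq_zero.mp (by linarith)
  have z3 : u 0 1 - u 1 0 = 0 := Complex.normSq_eq_zero.mp (by linarith)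
  have a1 : u 0 1 = 0 := by linear_combination (z1 + z3) / 2
  have a2 : u 1 0 = 0 := by linear_combination (z1 - z3) / 2
  have a3 : u 1 1 = u 0 0 := by linear_combination -z2
  have h0 := (unitary_normSq hu).1
  rw [a1, map_zero, add_zero, Complex.normSq_apply] at h0
  ext i j
  fin_cases i <;> fin_cases j <;>
    simp [adjRot, pauliBasis, sigmaX, sigmaY, sigmaZ, Matrix.trace, Matrix.mul_apply,
      Fin.sum_univ_two, Matrix.conjTranspose_apply, a1, a2, a3] <;> linarith

end OneQubit

section Stabilizer

variable {P : Type} [Fintype P] [DecidableEq P]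

lemma Wop_conjTranspose_mul_self (v : QV P) : (Wop v)ᴴ * Wop v = 1 := by
  simp only [Wop, conjTranspose_locOp, locOp_mul, pauliMat_unitary, locOp_one]

lemma PauliSection.exists_scalar {L : Submodule (ZMod 2) (QV P)} (σ : PauliSection L)
    (v : QV P) : ∃ c : ℂ, ‖c‖ = 1 ∧ σ.toFun v = c • Wop v := by
  obtain ⟨c, hc⟩ := σ.scalar v
  refine ⟨c, ?_, hc⟩
  have h := Matrix.mem_unitaryGroup_iff'.mp (σ.unitary v)
  rw [hc, Matrix.star_eq_conjTranspose, Matrix.conjTranspose_smul, smul_mul_smul_comm,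
    Wop_conjTranspose_mul_self] at h
  have h1 := congrFun (congrFun h 0) 0
  simp only [Matrix.smul_apply, Matrix.one_apply_eq, smul_eq_mul, mul_one] at h1
  have h2 := congrArg norm h1
  rw [norm_mul, norm_star, norm_one] at h2
  nlinarith [norm_nonneg c]

lemma Wop_single_anticomm {p : P} {w : V} {v : QV P} (h : omegaV w (v p) ≠ 0) :
    (Wop (Pi.single p w))ᴴ * Wop v = -(Wop v * (Wop (Pi.single p w))ᴴ) := by
  simp only [Wop, conjTranspose_locOp, locOp_mul]
  have : (fun q => (pauliMat ((Pi.single p w : QV P) q))ᴴ * pauliMat (v q)) =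
      fun q => (if q = p then (-1 : ℂ) else 1) •
        (pauliMat (v q) * (pauliMat ((Pi.single p w : QV P) q))ᴴ) := by
    funext q
    by_cases hq : q = p
    · subst hq
      simp only [Pi.single_eq_same, if_true]
      exact pauliMat_anticomm h
    · simp [hq, pauliMat]
  rw [this, locOp_smul]
  simp

/-- If a local operator preserves the code and `w` at `p` is detected by `L`, then
the components of `locOp u` along the coset of `w` modulo `L` cancel. -/
lemma sum_trace_eq_zero {L : Submodule (ZMod 2) (QV P)} (σ : PauliSection L)
    {U : MatP P} (hU : ∀ ψ ∈ code L σ, U *ᵥ ψ ∈ code L σ)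
    {p : P} {w : V} {v : QV P} (hv : v ∈ L) (h : omegaV w (v p) ≠ 0) :
    ∑ l : L, ((Wop (Pi.single p w))ᴴ * U * σ.toFun l).trace = 0 := by
  set S : MatP P := ∑ l : L, σ.toFun l with hS
  have hshift : ∀ a ∈ L, σ.toFun a * S = S := by
    intro a ha
    rw [hS, Finset.mul_sum]
    refine Fintype.sum_equiv (Equiv.addLeft (⟨a, ha⟩ : L)) _ _ fun l => ?_
    simp [σ.mul_of_mem a ha l l.2]
  have hshift' : S * σ.toFun v = S := by
    rw [hS, Finset.sum_mul]
    refine Fintype.sum_equiv (Equiv.addRight (⟨v, hv⟩ : L)) _ _ fun l => ?_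
    simp [σ.mul_of_mem l l.2 v hv]
  have hUS : σ.toFun v * (U * S) = U * S := by
    refine Matrix.ext_of_mulVec_single fun i => ?_
    rw [← Matrix.mulVec_mulVec, ← Matrix.mulVec_mulVec]
    refine hU _ (fun a ha => ?_) v hv
    rw [Matrix.mulVec_mulVec, hshift a ha]
  have hanti : (Wop (Pi.single p w))ᴴ * σ.toFun v = -(σ.toFun v * (Wop (Pi.single p w))ᴴ) := by
    obtain ⟨c, hc⟩ := σ.scalar v
    rw [hc, mul_smul_comm, smul_mul_assoc, Wop_single_anticomm h, smul_neg]
  rw [← Matrix.trace_sum, ← Finset.mul_sum, ← hS]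
  have h1 : ((Wop (Pi.single p w))ᴴ * U * S).trace = -((Wop (Pi.single p w))ᴴ * U * S).trace := by
    calc ((Wop (Pi.single p w))ᴴ * U * S).trace
        = ((Wop (Pi.single p w))ᴴ * σ.toFun v * (U * S)).trace := by
          rw [mul_assoc, mul_assoc, hUS]
      _ = -((σ.toFun v) * ((Wop (Pi.single p w))ᴴ * (U * S))).trace := by
          rw [hanti, neg_mul, Matrix.trace_neg, mul_assoc]
      _ = -((Wop (Pi.single p w))ᴴ * U * (S * σ.toFun v)).trace := by
          rw [Matrix.trace_mul_comm]; simp only [mul_assoc]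
      _ = _ := by rw [hshift']
  exact self_eq_neg.mp h1

lemma norm_trace_section {L : Submodule (ZMod 2) (QV P)} (σ : PauliSection L)
    (u : P → Matrix (Fin 2) (Fin 2) ℂ) (w l : QV P) :
    ‖((Wop w)ᴴ * locOp u * σ.toFun l).trace‖ =
      2 ^ Fintype.card P * ∏ q, pauliCoeff (u q) (w q + l q) := by
  obtain ⟨c, hc, h⟩ := σ.exists_scalar l
  rw [h, mul_smul_comm, Matrix.trace_smul, norm_smul, hc, one_mul]
  simp only [Wop, conjTranspose_locOp, locOp_mul, trace_locOp, norm_prod, norm_trace_pauliMat,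
    Finset.prod_mul_distrib, Finset.prod_const, Finset.card_univ]

lemma prod_pauliCoeff_single_le {L : Submodule (ZMod 2) (QV P)} (σ : PauliSection L)
    {u : P → Matrix (Fin 2) (Fin 2) ℂ}
    (hU : ∀ ψ ∈ code L σ, locOp u *ᵥ ψ ∈ code L σ)
    {p : P} (hp : IsProtected L p) {w : V} (hw : w ≠ 0) :
    ∏ q, pauliCoeff (u q) ((Pi.single p w : QV P) q) ≤
      ∑ l ∈ Finset.univ.erase (0 : L),
        ∏ q, pauliCoeff (u q) ((Pi.single p w : QV P) q + (l : QV P) q) := by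
  obtain ⟨w', hw'⟩ := exists_omegaV_ne_zero hw
  obtain ⟨v, hv, rfl⟩ := hp w'
  have h := sum_trace_eq_zero σ hU hv hw'
  rw [← Finset.add_sum_erase _ _ (Finset.mem_univ (0 : L))] at h
  have h1 := congrArg norm (eq_neg_of_add_eq_zero_left h)
  rw [norm_neg, norm_trace_section] at h1
  have h2 := norm_sum_le (Finset.univ.erase (0 : L))
    fun l : L => ((Wop (Pi.single p w))ᴴ * locOp u * σ.toFun l).trace
  rw [← h1] at h2
  simp only [norm_trace_section, ← Finset.mul_sum] at h2
  simpa using le_of_mul_le_mul_left h2 (by positivity)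

/-- No nonzero element of an isotropic `L` is supported at a single protected qubit. -/
lemma eq_zero_of_supported_single {L : Submodule (ZMod 2) (QV P)} (hL : Isotropic L) {p : P}
    (hp : IsProtected L p) {l : QV P} (hl : l ∈ L) (h : ∀ q ≠ p, l q = 0) : l = 0 := by
  by_contra hne
  have hlp : l p ≠ 0 := fun h0 => hne <| funext fun q => by
    by_cases hq : q = p
    · rw [hq, h0]; rfl
    · exact h q hq
  obtain ⟨w, hw⟩ := exists_omegaV_ne_zero hlp
  obtain ⟨v, hv, rfl⟩ := hp w
  refine hw ?_
  rw [← hL l hl v hv, omega, Finset.sum_eq_single p]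
  · intro q _ hq
    simp [h q hq, omegaV]
  · simp

/-- If `T` consists of pairwise non-contiguous protected qubits, a coset representative
of a single-qubit error on `T` that is itself supported on `T` has weight at least two. -/
lemma exists_two_le_weight {L : Submodule (ZMod 2) (QV P)} (hL : Isotropic L) {T : Set P}
    (hprot : ∀ t ∈ T, IsProtected L t)
    (hcontig : ∀ p ∈ T, ∀ q ∈ T, Contig L p q → p = q)
    {p : P} (hp : p ∈ T) {w : V} {l : QV P} (hl : l ∈ L) (hl0 : l ≠ 0)
    (hlT : ∀ q ∉ T, l q = 0) :
    ∃ q q' : P, q ≠ q' ∧ (Pi.single p w : QV P) q + l q ≠ 0 ∧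
      (Pi.single p w : QV P) q' + l q' ≠ 0 := by
  have hq : ∃ q, q ≠ p ∧ l q ≠ 0 := by
    by_contra! hcon
    exact hl0 (eq_zero_of_supported_single hL (hprot p hp) hl hcon)
  obtain ⟨q, hqp, hlq⟩ := hq
  have hqT : q ∈ T := by
    by_contra hqT
    exact hlq (hlT q hqT)
  by_cases hr : ∃ r, r ≠ q ∧ r ≠ p ∧ l r ≠ 0
  · obtain ⟨r, hrq, hrp, hlr⟩ := hr
    exact ⟨q, r, hrq.symm, by simpa [hqp] using hlq, by simpa [hrp] using hlr⟩
  · push Not at hr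
    exfalso
    by_cases hlp : l p = 0
    · refine hl0 (eq_zero_of_supported_single hL (hprot q hqT) hl fun r hrq => ?_)
      by_cases hrp : r = p
      · rw [hrp, hlp]
      · exact hr r hrq hrp
    · refine hqp (hcontig p hp q hqT (Or.inr ⟨l, hl, ?_⟩)).symm
      ext r
      simp only [supp, Set.mem_ofPred_eq, Set.mem_insert_iff, Set.mem_singleton_iff]
      constructor
      · intro hlr
        by_contra! hcon
        exact hlr (hr r hcon.2 hcon.1)
      · rintro (rfl | rfl) <;> assumption

lemma prod_pauliCoeff_le_sq {u : P → Matrix (Fin 2) (Fin 2) ℂ}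
    (hu : ∀ p, u p ∈ Matrix.unitaryGroup (Fin 2) ℂ) {ε : ℝ}
    (hε : ∀ p, ∀ w : V, w ≠ 0 → pauliCoeff (u p) w ≤ ε) {v : QV P} {q q' : P} (hqq : q ≠ q')
    (hq : v q ≠ 0) (hq' : v q' ≠ 0) : ∏ r, pauliCoeff (u r) (v r) ≤ ε ^ 2 := by
  have hε0 : 0 ≤ ε := (pauliCoeff_nonneg _ _).trans (hε q _ hq)
  rw [← Finset.prod_mul_prod_compl {q, q'}, Finset.prod_pair hqq]
  have h1 : ∏ r ∈ ({q, q'} : Finset P)ᶜ, pauliCoeff (u r) (v r) ≤ 1 :=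
    Finset.prod_le_one (fun r _ => pauliCoeff_nonneg _ _) fun r _ => pauliCoeff_le_one (hu r) _
  calc _ ≤ (ε * ε) * 1 := by
        gcongr
        · exact Finset.prod_nonneg fun r _ => pauliCoeff_nonneg _ _
        · exact pauliCoeff_nonneg _ _
        · exact hε q _ hq
        · exact hε q' _ hq'
    _ = ε ^ 2 := by ring

lemma le_prod_pauliCoeff_single {u : P → Matrix (Fin 2) (Fin 2) ℂ}
    (h0 : ∀ p, (1 / 2 : ℝ) ≤ pauliCoeff (u p) 0) (p : P) (w : V) :
    pauliCoeff (u p) w * (1 / 2) ^ Fintype.card P ≤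
      ∏ q, pauliCoeff (u q) ((Pi.single p w : QV P) q) := by
  rw [← Finset.mul_prod_erase Finset.univ _ (Finset.mem_univ p), Pi.single_eq_same]
  refine mul_le_mul_of_nonneg_left ?_ (pauliCoeff_nonneg _ _)
  calc ((1 : ℝ) / 2) ^ Fintype.card P ≤ (1 / 2) ^ (Finset.univ.erase p).card :=
        pow_le_pow_of_le_one (by norm_num) (by norm_num) (Finset.card_le_univ _)
    _ = ∏ q ∈ Finset.univ.erase p, (1 / 2 : ℝ) := by rw [Finset.prod_const]
    _ ≤ _ := by
        refine Finset.prod_le_prod (fun _ _ => by norm_num) fun q hq => ?_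
        rw [Pi.single_eq_of_ne (Finset.ne_of_mem_erase hq)]
        exact h0 q

lemma sum_prod_pauliCoeff_le {L : Submodule (ZMod 2) (QV P)} (hL : Isotropic L) {T : Set P}
    (hprot : ∀ t ∈ T, IsProtected L t)
    (hcontig : ∀ p ∈ T, ∀ q ∈ T, Contig L p q → p = q)
    {u : P → Matrix (Fin 2) (Fin 2) ℂ}
    (hu : ∀ p, u p ∈ Matrix.unitaryGroup (Fin 2) ℂ) {ε : ℝ}
    (hε : ∀ p, ∀ w : V, w ≠ 0 → pauliCoeff (u p) w ≤ ε)
    (hT0 : ∀ p ∉ T, ∀ w : V, w ≠ 0 → pauliCoeff (u p) w = 0) {p : P} (hp : p ∈ T) (w : V) :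
    ∑ l ∈ Finset.univ.erase (0 : L),
        ∏ q, pauliCoeff (u q) ((Pi.single p w : QV P) q + (l : QV P) q) ≤
      (Fintype.card L : ℝ) * ε ^ 2 := by
  have hterm : ∀ l ∈ Finset.univ.erase (0 : L),
      ∏ q, pauliCoeff (u q) ((Pi.single p w : QV P) q + (l : QV P) q) ≤ ε ^ 2 := by
    intro l hl
    have hl0 : (l : QV P) ≠ 0 := by simpa using hl
    by_cases hlT : ∀ q ∉ T, (l : QV P) q = 0
    · obtain ⟨q, q', hqq, hq, hq'⟩ := exists_two_le_weight hL hprot hcontig hp l.2 hl0 hlT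
      exact prod_pauliCoeff_le_sq (v := fun r => (Pi.single p w : QV P) r + (l : QV P) r)
        hu hε hqq hq hq'
    · push Not at hlT
      obtain ⟨q, hqT, hlq⟩ := hlT
      rw [Finset.prod_eq_zero (Finset.mem_univ q)]
      · positivity
      · refine hT0 q hqT _ ?_
        have hqp : q ≠ p := fun h => hqT (h ▸ hp)
        rwa [Pi.single_eq_of_ne hqp, zero_add]
  refine (Finset.sum_le_card_nsmul _ _ _ hterm).trans ?_
  rw [nsmul_eq_mul]
  gcongr
  exact_mod_cast Finset.card_le_univ _

/-- Automorphisms supported on `T` and close to the identity are trivial. -/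
lemma autSet_eq_one_of_near {L : Submodule (ZMod 2) (QV P)} (hL : Isotropic L)
    (σ : PauliSection L) {T : Set P} (hprot : ∀ t ∈ T, IsProtected L t)
    (hcontig : ∀ p ∈ T, ∀ q ∈ T, Contig L p q → p = q) :
    ∃ η > 0, ∀ g ∈ autSet L σ, (∀ p ∉ T, g p = 1) → (∀ p, 3 - η < (g p).trace) → g = 1 := by
  set N : ℝ := (Fintype.card L : ℝ) with hN
  have hN1 : 1 ≤ N := by
    rw [hN]; exact_mod_cast Fintype.card_pos (α := L)
  set δ : ℝ := (1 / 2) ^ Fintype.card P / N with hδ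
  have hδ0 : 0 < δ := by positivity
  have hδN : δ * N = (1 / 2) ^ Fintype.card P := by rw [hδ]; field_simp
  have hδ1 : δ ≤ 1 := by
    have : ((1 : ℝ) / 2) ^ Fintype.card P ≤ 1 := pow_le_one₀ (by norm_num) (by norm_num)
    nlinarith
  refine ⟨δ ^ 2, by positivity, fun g hg hgT hgn => ?_⟩
  obtain ⟨u, hu, hug, hU⟩ := hg
  have h0 : ∀ p, (1 / 2 : ℝ) ≤ pauliCoeff (u p) 0 := by
    intro p
    have h1 := pauliCoeff_zero_sq (hu p)
    rw [hug] at h1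
    nlinarith [hgn p, pauliCoeff_nonneg (u p) 0]
  have hδw : ∀ p, ∀ w : V, w ≠ 0 → pauliCoeff (u p) w < δ := by
    intro p w hw
    have h1 := pauliCoeff_zero_sq (hu p)
    rw [hug] at h1
    refine lt_of_pow_lt_pow_left₀ 2 hδ0.le ?_
    nlinarith [hgn p, pauliCoeff_sq_le (hu p) hw]
  have hT0 : ∀ p ∉ T, ∀ w : V, w ≠ 0 → pauliCoeff (u p) w = 0 := by
    intro p hp w hw
    have h1 := pauliCoeff_zero_sq (hu p)
    rw [hug, hgT p hp, Matrix.trace_one, Fintype.card_fin] at h1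
    have h2 := pauliCoeff_sq_le (hu p) hw
    push_cast at h1
    nlinarith [pauliCoeff_nonneg (u p) w]
  suffices hall : ∀ p, ∀ w : V, w ≠ 0 → pauliCoeff (u p) w = 0 by
    funext p
    rw [← hug p, adjRot_eq_one (hu p) (hall p)]
    rfl
  intro p₁ w₁ hw₁
  have : Nonempty (P × {w : V // w ≠ 0}) := ⟨(p₁, ⟨w₁, hw₁⟩)⟩
  obtain ⟨⟨p, w, hw⟩, hmax⟩ :=
    Finite.exists_max fun x : P × {w : V // w ≠ 0} => pauliCoeff (u x.1) x.2
  have hmax' : ∀ q, ∀ w' : V, w' ≠ 0 → pauliCoeff (u q) w' ≤ pauliCoeff (u p) w :=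
    fun q w' hw' => hmax (q, ⟨w', hw'⟩)
  set ε := pauliCoeff (u p) w with hε
  have hε0 : 0 ≤ ε := pauliCoeff_nonneg _ _
  suffices hz : ε = 0 from
    le_antisymm (hz ▸ hmax' p₁ w₁ hw₁) (pauliCoeff_nonneg _ _)
  by_cases hp : p ∈ T
  swap
  · exact hT0 p hp w hw
  have hlow : ε * (1 / 2) ^ Fintype.card P ≤
      ∏ q, pauliCoeff (u q) ((Pi.single p w : QV P) q) :=
    le_prod_pauliCoeff_single h0 p w
  have hupp : ∑ l ∈ Finset.univ.erase (0 : L),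
        ∏ q, pauliCoeff (u q) ((Pi.single p w : QV P) q + (l : QV P) q) ≤ N * ε ^ 2 :=
    sum_prod_pauliCoeff_le hL hprot hcontig hu hmax' hT0 hp w
  have h3 := hlow.trans ((prod_pauliCoeff_single_le σ hU (hprot p hp) hw).trans hupp)
  have h4 : ε < δ := hδw p w hw
  by_contra hne
  have hpos : 0 < ε := lt_of_le_of_ne hε0 (Ne.symm hne)
  rw [← hδN] at h3
  nlinarith [mul_pos (mul_pos hpos (sub_pos.mpr h4)) (by linarith : 0 < N)]

end Stabilizer

/-- **Lemma (no one-parameter groups supported on `T`).** Let `(L, σ)` be normalised,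
`L` free of zero, trivial, and Bell factors, and let `T ⊆ P` contain exactly one qubit
from each protected contiguity class and no qubit from any gauge-type class. Then every
one-parameter subgroup `S¹ → A(L, σ)` with support contained in `T` is trivial. -/
theorem one_parameter_trivial {P : Type} [Fintype P] [DecidableEq P]
    (L : Submodule (ZMod 2) (QV P)) (hL : Isotropic L)
    (hzero : ¬ HasZeroFactor L) (htriv : ¬ HasTrivialFactor L)
    (hbell : ¬ HasBellFactor L)
    (σ : PauliSection L) (hnorm : Normalised L σ)
    (T : Set P)
    (hT1 : ∀ t ∈ T, IsProtected L t)
    (hT2 : ∀ p : P, IsProtected L p → ∃! t : P, t ∈ T ∧ Contig L p t)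
    (γ : Circle →* (P → Rot)) (hcont : Continuous γ)
    (hmem : ∀ c : Circle, γ c ∈ autSet L σ)
    (hsupp : ∀ c : Circle, ∀ p ∉ T, γ c p = 1) :
    ∀ c : Circle, γ c = 1 := by
  have hcontig : ∀ p ∈ T, ∀ q ∈ T, Contig L p q → p = q := fun p hp q hq hpq =>
    (hT2 p (hT1 p hp)).unique ⟨hp, Or.inl rfl⟩ ⟨hq, hpq⟩
  obtain ⟨η, hη, hnear⟩ := autSet_eq_one_of_near hL σ hT1 hcontig
  intro c
  obtain ⟨t, rfl⟩ : ∃ t : ℝ, Circle.exp t = c := ⟨Complex.arg c, Circle.exp_arg c⟩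
  have hlim : Filter.Tendsto (fun n : ℕ => t / n) Filter.atTop (nhds 0) :=
    tendsto_const_div_atTop_nhds_zero_nat t
  have hev : ∀ᶠ n : ℕ in Filter.atTop, ∀ p, 3 - η < (γ (Circle.exp (t / n)) p).trace := by
    refine Filter.eventually_all.mpr fun p => ?_
    have hc : Continuous fun s : ℝ => (γ (Circle.exp s) p).trace :=
      ((continuous_apply p).comp (hcont.comp Circle.exp.continuous)).matrix_trace
    refine (hc.tendsto 0 |>.comp hlim).eventually (lt_mem_nhds ?_)
    simp [hη]
  obtain ⟨n, hn, hn0⟩ := (hev.and (Filter.eventually_gt_atTop 0)).exists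
  have h1 : γ (Circle.exp (t / n)) = 1 := hnear _ (hmem _) (hsupp _) hn
  have h2 : Circle.exp t = Circle.exp (t / n) ^ n := by
    rw [← Circle.exp_nsmul, nsmul_eq_mul, mul_div_cancel₀]
    exact_mod_cast hn0.ne'
  rw [h2, map_pow, h1, one_pow]

end Stab
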